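/- Let x ∈ 𝔽 and r ∈ ℝ. If [r]n ≤ x (as extended reals) then r ≤ x + ∇2n+(x)/2, and the inequality is strict whenever x is odd. -/

import Mathlib

noncomputable section

open scoped Classical

namespace FPVerif

/-- The set of finite IEEE 754 binary floating-point numbers with
precision `p` and maximum exponent `emax` (minimum exponent `1 - emax`),
viewed as a set of real numbers. -/
def F (p emax : ℤ) : Set ℝ :=
  {x | ∃ (s : ℝ) (e M : ℤ), (s = 1 ∨ s = -1) ∧
    1 - emax ≤ e ∧ e ≤ emax ∧ (0 : ℝ) ≤ (M : ℝ) ∧ (M : ℝ) ≤ (2 : ℝ) ^ p - 1 ∧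
    x = s * (M : ℝ) * (2 : ℝ) ^ (e + 1 - p)}

/-- The smallest positive float. -/
def fmin (p emax : ℤ) : ℝ := (2 : ℝ) ^ ((1 - emax) + 1 - p)

/-- The largest float. -/
def fmax (p emax : ℤ) : ℝ := (2 : ℝ) ^ emax * (2 - (2 : ℝ) ^ (1 - p))

/-- The successor of `x` in `F p emax` (meaningful when `x ∈ F` and `x < fmax`). -/
def fsucc (p emax : ℤ) (x : ℝ) : ℝ := sInf {y | y ∈ F p emax ∧ x < y}

/-- The predecessor of `x` in `F p emax` (meaningful when `x ∈ F` and `-fmax < x`). -/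
def fpred (p emax : ℤ) (x : ℝ) : ℝ := sSup {y | y ∈ F p emax ∧ y < x}

/-- Round toward minus infinity, valued in the extended reals. -/
def rndDown (p emax : ℤ) (x : ℝ) : EReal :=
  if x < -fmax p emax then ⊥
  else ((sSup {z | z ∈ F p emax ∧ z ≤ x} : ℝ) : EReal)

/-- Round toward plus infinity, valued in the extended reals. -/
def rndUp (p emax : ℤ) (x : ℝ) : EReal :=
  if fmax p emax < x then ⊤
  else ((sInf {z | z ∈ F p emax ∧ x ≤ z} : ℝ) : EReal)

/-- Round toward zero, valued in the extended reals. -/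
def rndZero (p emax : ℤ) (x : ℝ) : EReal :=
  if 0 < x then rndDown p emax x else rndUp p emax x

/-- A float `z` is even if it is zero or its mantissa digit string ends in 0,
i.e. `z / 2 ^ (e_z + 1 - p)` is an even integer, where
`e_z = max (1 - emax) ⌊log₂ |z|⌋`. -/
def FEven (p emax : ℤ) (z : ℝ) : Prop :=
  z = 0 ∨ ∃ k : ℤ, Even k ∧
    z = (k : ℝ) * (2 : ℝ) ^ (max (1 - emax) (Int.log 2 |z|) + 1 - p)

/-- The set of floats at minimal distance from `x`. -/
def nearestSet (p emax : ℤ) (x : ℝ) : Set ℝ :=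
  {z | z ∈ F p emax ∧ ∀ w ∈ F p emax, |x - z| ≤ |x - w|}

/-- The float at minimal distance from `x`, a tie being broken by
choosing the even one. -/
def nearest (p emax : ℤ) (x : ℝ) : ℝ :=
  if h : ∃ z, z ∈ nearestSet p emax x ∧ FEven p emax z then h.choose
  else if h2 : ∃ z, z ∈ nearestSet p emax x then h2.choose
  else 0

/-- Round to nearest (ties to even), valued in the extended reals. -/
def rndNear (p emax : ℤ) (x : ℝ) : EReal :=
  if (2 : ℝ) ^ emax * (2 - (2 : ℝ) ^ (-p)) ≤ x then ⊤
  else if x ≤ -((2 : ℝ) ^ emax * (2 - (2 : ℝ) ^ (-p))) then ⊥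
  else ((nearest p emax x : ℝ) : EReal)

/-- Twice the downward round-to-nearest error bound `∇2n−`. -/
def nablaNm (p emax : ℤ) (x : ℝ) : ℝ :=
  if x = -fmax p emax then x - fsucc p emax x else fpred p emax x - x

/-- Twice the upward round-to-nearest error bound `∇2n+`. -/
def nablaNp (p emax : ℤ) (x : ℝ) : ℝ :=
  if x = fmax p emax then x - fpred p emax x else fsucc p emax x - x

end FPVerif

namespace FPVerif

lemma F_neg {p emax : ℤ} {x : ℝ} (hx : x ∈ F p emax) : -x ∈ F p emax := by
  obtain ⟨s, e, M, hs, h1, h2, h3, h4, h5⟩ := hx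
  refine ⟨-s, e, M, ?_, h1, h2, h3, h4, by rw [h5]; ring⟩
  rcases hs with h | h
  · right; rw [h]
  · left; rw [h]; norm_num

lemma FEven_neg {p emax : ℤ} {x : ℝ} (hx : FEven p emax x) : FEven p emax (-x) := by
  rcases hx with h | ⟨k, hk, h⟩
  · left; rw [h]; simp
  · right
    refine ⟨-k, hk.neg, ?_⟩
    rw [abs_neg]; push_cast; rw [neg_mul, ← h]

lemma F_finite (p emax : ℤ) (hp : 2 ≤ p) : (F p emax).Finite := by
  lift p to ℕ using by omega
  have hfin : (({1, -1} : Set ℝ) ×ˢ ((Set.Icc (1 - emax) emax) ×ˢ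
      (Set.Icc (0:ℤ) (2 ^ p)))).Finite :=
    (Set.toFinite _).prod ((Set.finite_Icc _ _).prod (Set.finite_Icc _ _))
  refine (hfin.image (fun t => t.1 * (t.2.2 : ℝ) * (2:ℝ) ^ (t.2.1 + 1 - (p:ℤ)))).subset ?_
  rintro x ⟨s, e, M, hs, h1, h2, h3, h4, h5⟩
  refine ⟨(s, e, M), ⟨?_, ⟨h1, h2⟩, ?_, ?_⟩, h5.symm⟩
  · simpa using hs
  · exact_mod_cast h3
  · have : (M:ℝ) ≤ (2:ℝ) ^ p := by
      rw [zpow_natCast] at h4; linarith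
    exact_mod_cast this

lemma zero_mem {p emax : ℤ} (hp : 2 ≤ p) (he : 1 ≤ emax) : (0:ℝ) ∈ F p emax := by
  refine ⟨1, emax, 0, Or.inl rfl, by omega, le_refl _, by simp, ?_, by simp⟩
  have : (1:ℝ) ≤ 2 ^ p := one_le_zpow₀ (by norm_num) (by omega)
  push_cast; linarith

lemma fmax_eq (p emax : ℤ) : fmax p emax = ((2:ℝ) ^ p - 1) * (2:ℝ) ^ (emax + 1 - p) := by
  unfold fmax
  have h1 : (2:ℝ) ^ (emax + 1 - p) = 2 ^ emax * 2 ^ (1 - p) := by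
    rw [← zpow_add₀ (by norm_num)]; congr 1; ring
  have h2 : (2:ℝ) ^ p * 2 ^ (1 - p) = 2 := by
    rw [← zpow_add₀ (by norm_num)]; simp
  rw [h1]
  linear_combination (-(2:ℝ) ^ emax) * h2

lemma fmax_mem {p emax : ℤ} (hp : 2 ≤ p) (he : 1 ≤ emax) : fmax p emax ∈ F p emax := by
  rw [fmax_eq]
  have : (1:ℝ) ≤ 2 ^ p := one_le_zpow₀ (by norm_num) (by omega)
  lift p to ℕ using by omega
  refine ⟨1, emax, 2 ^ p - 1, Or.inl rfl, by omega, le_refl _, ?_, ?_, ?_⟩ <;>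
    push_cast <;> rw [zpow_natCast] at * <;> linarith

lemma pred_fmax {p emax : ℤ} (hp : 2 ≤ p) {y : ℝ} (hy : y ∈ F p emax)
    (hne : y ≠ fmax p emax) : y ≤ fmax p emax - (2:ℝ) ^ (emax + 1 - p) := by
  rw [fmax_eq] at *
  obtain ⟨s, e, M, hs, h1, h2, h3, h4, h5⟩ := hy
  have hu : (0:ℝ) < 2 ^ (emax + 1 - p) := by positivity
  have h4p : (4:ℝ) ≤ 2 ^ p := by
    calc (4:ℝ) = 2 ^ (2:ℤ) := by norm_num
      _ ≤ 2 ^ p := zpow_le_zpow_right₀ (by norm_num) hp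
  have hv : (0:ℝ) < 2 ^ (e + 1 - p) := by positivity
  rcases hs with rfl | rfl
  · rcases eq_or_lt_of_le h2 with rfl | hlt
    · have : (M:ℝ) ≤ 2 ^ p - 2 := by
        have hne' : (M:ℝ) ≠ 2 ^ p - 1 := by
          intro hM; apply hne; rw [h5, hM]; ring
        have hl := lt_of_le_of_ne h4 hne'
        lift p to ℕ using by omega
        rw [zpow_natCast] at *
        have : M < 2 ^ p - 1 := by exact_mod_cast hl
        have : M ≤ 2 ^ p - 2 := by omega
        exact_mod_cast this
      rw [h5]; nlinarith
    · have hle : (2:ℝ) ^ (e + 1 - p) * 2 ≤ 2 ^ (emax + 1 - p) := by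
        rw [← zpow_add_one₀ (by norm_num)]
        exact zpow_le_zpow_right₀ (by norm_num) (by omega)
      rw [h5]
      have : (M:ℝ) * 2 ^ (e + 1 - p) ≤ (2 ^ p - 1) * 2 ^ (e + 1 - p) := by gcongr
      nlinarith
  · have : (0:ℝ) ≤ M * 2 ^ (e + 1 - p) := by positivity
    rw [h5]; nlinarith

lemma le_fmax {p emax : ℤ} (hp : 2 ≤ p) {y : ℝ} (hy : y ∈ F p emax) : y ≤ fmax p emax := by
  by_cases h : y = fmax p emax
  · exact h.le
  · have := pred_fmax hp hy h
    have hu : (0:ℝ) < 2 ^ (emax + 1 - p) := by positivity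
    linarith

lemma canon {p emax : ℤ} (hp : 2 ≤ p) {z : ℝ} (hz : z ∈ F p emax) (hpos : 0 < z) :
    ∃ k e : ℤ, e = max (1 - emax) (Int.log 2 |z|) ∧ e ≤ emax ∧ 0 < k ∧ (k:ℝ) < 2 ^ p ∧
      z = (k:ℝ) * (2:ℝ) ^ (e + 1 - p) := by
  obtain ⟨s, e0, M, hs, h1, h2, h3, h4, h5⟩ := hz
  rw [abs_of_pos hpos]
  have hv : (0:ℝ) < 2 ^ (e0 + 1 - p) := by positivity
  have hs1 : s = 1 := by
    rcases hs with h | h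
    · exact h
    · exfalso
      have : (0:ℝ) ≤ M * 2 ^ (e0 + 1 - p) := by positivity
      rw [h] at h5; linarith
  rw [hs1, one_mul] at h5
  have hlt : z < (2:ℝ) ^ (e0 + 1) := by
    have : (2:ℝ) ^ (e0 + 1) = 2 ^ p * 2 ^ (e0 + 1 - p) := by
      rw [← zpow_add₀ (by norm_num)]; congr 1; ring
    rw [h5, this]
    exact mul_lt_mul_of_pos_right (by linarith) hv
  have hlog : Int.log 2 z ≤ e0 := by
    have := (Int.lt_zpow_iff_log_lt (b := 2) (by norm_num) hpos (x := e0 + 1)).1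
      (by exact_mod_cast hlt)
    omega
  set e := max (1 - emax) (Int.log 2 z) with he
  have hee : e ≤ e0 := max_le h1 hlog
  obtain ⟨n, hn⟩ := Int.le.dest hee
  have hzk : z = ((M * 2 ^ n : ℤ):ℝ) * (2:ℝ) ^ (e + 1 - p) := by
    rw [h5, ← hn]; push_cast
    rw [mul_assoc, ← zpow_natCast, ← zpow_add₀ (by norm_num)]; congr 2; ring
  have hw : (0:ℝ) < 2 ^ (e + 1 - p) := by positivity
  refine ⟨M * 2 ^ n, e, rfl, by omega, ?_, ?_, hzk⟩
  · have : (0:ℝ) < ((M * 2 ^ n : ℤ):ℝ) := by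
      by_contra hc
      push Not at hc
      nlinarith
    exact_mod_cast this
  · have h6 : z < (2:ℝ) ^ (e + 1) := by
      have := Int.lt_zpow_succ_log_self (b := 2) (by norm_num) z
      refine lt_of_lt_of_le (by exact_mod_cast this) (zpow_le_zpow_right₀ (by norm_num) ?_)
      have := le_max_right (1 - emax) (Int.log 2 z)
      omega
    have : (2:ℝ) ^ (e + 1) = 2 ^ p * 2 ^ (e + 1 - p) := by
      rw [← zpow_add₀ (by norm_num)]; congr 1; ring
    rw [this, hzk] at h6
    exact lt_of_mul_lt_mul_right h6 hw.le

lemma between_pos {p emax : ℤ} (hp : 2 ≤ p) {x y : ℝ} (hx : x ∈ F p emax)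
    (hy : y ∈ F p emax) (hpos : 0 < x) (hxy : x < y) (ox : ¬ FEven p emax x)
    (oy : ¬ FEven p emax y) : ∃ w ∈ F p emax, x < w ∧ w < y := by
  have hy0 : 0 < y := hpos.trans hxy
  obtain ⟨k, e, he, hem, hk0, hk, hxk⟩ := canon hp hx hpos
  obtain ⟨m, f, hf, hfm, hm0, hm, hym⟩ := canon hp hy hy0
  have hko : ¬ Even k := fun h => ox (Or.inr ⟨k, h, by rw [← he]; exact hxk⟩)
  have hmo : ¬ Even m := fun h => oy (Or.inr ⟨m, h, by rw [← hf]; exact hym⟩)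
  have hef : e ≤ f := by
    rw [he, hf, abs_of_pos hpos, abs_of_pos hy0]
    exact max_le_max le_rfl (Int.log_mono_right hpos hxy.le)
  have hemin : 1 - emax ≤ e := by rw [he]; exact le_max_left _ _
  obtain ⟨n, hn⟩ := Int.le.dest hef
  have hu : (0:ℝ) < 2 ^ (e + 1 - p) := by positivity
  have hyk : y = ((m * 2 ^ n : ℤ):ℝ) * (2:ℝ) ^ (e + 1 - p) := by
    rw [hym, ← hn]; push_cast
    rw [mul_assoc, ← zpow_natCast, ← zpow_add₀ (by norm_num)]; congr 2; ring
  have hkm : k < m * 2 ^ n := by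
    rw [hxk, hyk] at hxy
    exact_mod_cast lt_of_mul_lt_mul_right hxy hu.le
  have hk1 : Even (k + 1) := by
    rw [Int.not_even_iff_odd] at hko; exact hko.add_one
  -- when `f > e`, `y` is a normal number
  have hnorm : n ≠ 0 → (2:ℝ) ^ (p - 1) ≤ m := by
    intro hn0
    have hfl : f = Int.log 2 y := by
      rw [abs_of_pos hy0] at hf
      rcases le_total (1 - emax) (Int.log 2 y) with h | h
      · rw [hf, max_eq_right h]
      · rw [max_eq_left h] at hf; omega
    have h1 : (2:ℝ) ^ f ≤ y := by
      rw [hfl]; exact_mod_cast Int.zpow_log_le_self (b := 2) (by norm_num) hy0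
    have : (2:ℝ) ^ f = 2 ^ (p - 1) * 2 ^ (f + 1 - p) := by
      rw [← zpow_add₀ (by norm_num)]; congr 1; ring
    rw [this, hym] at h1
    exact le_of_mul_le_mul_right h1 (by positivity)
  obtain ⟨q, rfl⟩ : ∃ q : ℕ, p = (q:ℤ) + 2 := ⟨(p - 2).toNat, by omega⟩
  have hp1 : (2:ℝ) ^ ((q:ℤ) + 2 - 1) = ((2 ^ (q + 1) : ℤ) : ℝ) := by
    push_cast; rw [← zpow_natCast]; congr 1; push_cast; ring
  have hp2 : (2:ℝ) ^ ((q:ℤ) + 2) = ((2 ^ (q + 2) : ℤ) : ℝ) := by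
    push_cast; rw [← zpow_natCast]; congr 1
  rw [hp1] at hnorm
  rw [hp2] at hk hm
  norm_cast at hk hm hnorm
  have hne : k + 1 ≠ m * 2 ^ n := by
    intro heq
    by_cases hn0 : n = 0
    · subst hn0; simp only [pow_zero, mul_one] at heq; rw [heq] at hk1; exact hmo hk1
    · have h1 := hnorm hn0
      have h2 : (2:ℤ) ^ 1 ≤ 2 ^ n := pow_le_pow_right₀ (by norm_num) (by omega)
      have h3 : m * 2 ≤ m * 2 ^ n := mul_le_mul_of_nonneg_left (by simpa using h2) hm0.le
      have h4 : m = 2 ^ (q + 1) := by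
        push_cast at *
        have : (2:ℤ) ^ (q + 2) = 2 * 2 ^ (q + 1) := by ring
        omega
      apply hmo; rw [h4, pow_succ]; exact even_two.mul_left _
  have hlt : k + 1 < m * 2 ^ n := lt_of_le_of_ne hkm hne
  refine ⟨((k + 1 : ℤ):ℝ) * 2 ^ (e + 1 - ((q:ℤ) + 2)), ?_, ?_, ?_⟩
  · by_cases hc : k + 1 < 2 ^ (q + 2)
    · refine ⟨1, e, k + 1, Or.inl rfl, hemin, hem, ?_, ?_, by ring⟩
      · exact_mod_cast (by omega : 0 ≤ k + 1)
      · rw [hp2, le_sub_iff_add_le]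
        exact_mod_cast hc
    · have hkk : k + 1 = 2 ^ (q + 2) := by push_cast at *; omega
      have hn0 : n ≠ 0 := by
        rintro rfl; simp only [pow_zero, mul_one] at hlt; push_cast at *; omega
      refine ⟨1, e + 1, 2 ^ (q + 1), Or.inl rfl, by omega, by omega, ?_, ?_, ?_⟩
      · positivity
      · rw [hp2, le_sub_iff_add_le]
        have : (2:ℤ) ^ (q + 1) + 1 ≤ 2 ^ (q + 2) := by
          have h1 : (2:ℤ) ^ (q + 2) = 2 * 2 ^ (q + 1) := by ring
          have h2 : (0:ℤ) < 2 ^ (q + 1) := by positivity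
          omega
        exact_mod_cast this
      · rw [hkk]; push_cast
        have : (2:ℝ) ^ (e + 1 + 1 - ((q:ℤ) + 2)) = 2 ^ (e + 1 - ((q:ℤ) + 2)) * 2 := by
          rw [← zpow_add_one₀ (by norm_num)]; congr 1; ring
        rw [this]; ring
  · rw [hxk]
    exact mul_lt_mul_of_pos_right (by push_cast; linarith) hu
  · rw [hyk]
    exact mul_lt_mul_of_pos_right (by exact_mod_cast hlt) hu

lemma between {p emax : ℤ} (hp : 2 ≤ p) (he : 1 ≤ emax) {x y : ℝ} (hx : x ∈ F p emax)
    (hy : y ∈ F p emax) (hxy : x < y) (ox : ¬ FEven p emax x)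
    (oy : ¬ FEven p emax y) : ∃ w ∈ F p emax, x < w ∧ w < y := by
  have hx0 : x ≠ 0 := fun h => ox (Or.inl h)
  have hy0 : y ≠ 0 := fun h => oy (Or.inl h)
  rcases lt_or_gt_of_ne hx0 with h | h
  · rcases lt_or_gt_of_ne hy0 with h' | h'
    · obtain ⟨w, hw, h1, h2⟩ := between_pos hp (F_neg hy) (F_neg hx) (by linarith)
        (neg_lt_neg hxy) (fun h => oy (by simpa using FEven_neg h))
        (fun h => ox (by simpa using FEven_neg h))
      exact ⟨-w, F_neg hw, by linarith, by linarith⟩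
    · exact ⟨0, zero_mem hp he, h, h'⟩
  · exact between_pos hp hx hy h hxy ox oy

lemma nearest_spec {p emax : ℤ} (hp : 2 ≤ p) (he : 1 ≤ emax) (r : ℝ) :
    nearest p emax r ∈ nearestSet p emax r ∧
    ((∃ z, z ∈ nearestSet p emax r ∧ FEven p emax z) → FEven p emax (nearest p emax r)) := by
  unfold nearest
  split_ifs with h h2
  · exact ⟨h.choose_spec.1, fun _ => h.choose_spec.2⟩
  · exact ⟨h2.choose_spec, fun h' => absurd h' h⟩
  · exfalso
    obtain ⟨z, hz, hmin⟩ := Set.exists_min_image (F p emax) (fun w => |r - w|)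
      (F_finite p emax hp) ⟨0, zero_mem hp he⟩
    exact h2 ⟨z, hz, hmin⟩

lemma fsucc_spec {p emax : ℤ} (hp : 2 ≤ p) (he : 1 ≤ emax) {x : ℝ} (hx : x < fmax p emax) :
    fsucc p emax x ∈ F p emax ∧ x < fsucc p emax x ∧
      ∀ w ∈ F p emax, x < w → fsucc p emax x ≤ w := by
  have hfin : ({y | y ∈ F p emax ∧ x < y}).Finite :=
    (F_finite p emax hp).subset fun y hy => hy.1
  have hne : ({y | y ∈ F p emax ∧ x < y}).Nonempty := ⟨_, fmax_mem hp he, hx⟩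
  have := hne.csInf_mem hfin
  exact ⟨this.1, this.2, fun w hw hxw => csInf_le hfin.bddBelow ⟨hw, hxw⟩⟩

lemma thr_eq (p emax : ℤ) : (2 : ℝ) ^ emax * (2 - (2 : ℝ) ^ (-p)) =
    fmax p emax + (2:ℝ) ^ (emax + 1 - p) / 2 := by
  unfold fmax
  have h1 : (2:ℝ) ^ (emax + 1 - p) = 2 ^ emax * 2 ^ (-p) * 2 := by
    rw [← zpow_add₀ (by norm_num), ← zpow_add_one₀ (by norm_num)]; congr 1; ring
  have h2 : (2:ℝ) ^ (1 - p) = 2 ^ (-p) * 2 := by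
    rw [← zpow_add_one₀ (by norm_num)]; congr 1; ring
  rw [h1, h2]; ring

end FPVerif

open FPVerif

/-- If `x ∈ 𝔽` and `[r]n ≤ x`, then `r ≤ x + ∇2n+(x)/2`, strictly whenever
`x` is odd. -/
theorem rndNear_le_imp (p emax : ℤ) (hp : 2 ≤ p) (he : 1 ≤ emax)
    (x : ℝ) (hx : x ∈ F p emax) (r : ℝ)
    (h : rndNear p emax r ≤ (x : EReal)) :
    r ≤ x + nablaNp p emax x / 2 ∧
    (¬ FEven p emax x → r < x + nablaNp p emax x / 2) := by
  have hu : (0:ℝ) < 2 ^ (emax + 1 - p) := by positivity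
  unfold rndNear at h
  rw [thr_eq] at h
  by_cases hmax : x = fmax p emax
  · -- here the bound is always strict
    suffices hs : r < x + nablaNp p emax x / 2 from ⟨hs.le, fun _ => hs⟩
    have hr : r < fmax p emax + (2:ℝ) ^ (emax + 1 - p) / 2 := by
      by_contra hc
      push Not at hc
      rw [if_pos hc] at h
      exact absurd h (by simp)
    have hpred : fpred p emax x ≤ fmax p emax - (2:ℝ) ^ (emax + 1 - p) := by
      refine csSup_le ⟨-fmax p emax, F_neg (fmax_mem hp he), ?_⟩ ?_
      · have := pred_fmax hp (zero_mem hp he) (emax := emax) ?_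
        · rw [hmax]; linarith
        · rw [fmax_eq]
          have h1 : (1:ℝ) < 2 ^ p := one_lt_zpow₀ (by norm_num) (by omega)
          have : 0 < ((2:ℝ) ^ p - 1) * 2 ^ (emax + 1 - p) := mul_pos (by linarith) hu
          exact this.ne
      · rintro y ⟨hy, hyx⟩
        exact pred_fmax hp hy (by rw [← hmax]; exact hyx.ne)
    unfold nablaNp
    rw [if_pos hmax]
    linarith
  · have hlt : x < fmax p emax := lt_of_le_of_ne (le_fmax hp hx) hmax
    obtain ⟨hyF, hxy, hmin⟩ := fsucc_spec hp he hlt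
    unfold nablaNp
    rw [if_neg hmax]
    set y := fsucc p emax x with hydef
    split_ifs at h with h1 h2
    · exact absurd h (by simp)
    · have := le_fmax hp (F_neg hx)
      exact ⟨by linarith, fun _ => by linarith⟩
    · obtain ⟨⟨hzF, hzmin⟩, hev⟩ := nearest_spec hp he r
      set z := nearest p emax r with hz
      have hzx : z ≤ x := by exact_mod_cast h
      have hle : r ≤ x + (y - x) / 2 := by
        by_contra hc
        push Not at hc
        have h3 := hzmin y hyF
        rw [abs_of_pos (by linarith : 0 < r - z)] at h3
        have := abs_lt.2 (⟨by linarith, by linarith⟩ : -(r - z) < r - y ∧ r - y < r - z)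
        linarith
      refine ⟨hle, fun ox => lt_of_le_of_ne hle fun heq => ?_⟩
      have h3 := hzmin x hx
      rw [abs_of_pos (by linarith : 0 < r - z), abs_of_pos (by linarith : 0 < r - x)] at h3
      have hzx' : z = x := by linarith
      by_cases ey : FEven p emax y
      · apply ox
        rw [← hzx']
        refine hev ⟨y, ⟨hyF, fun w hw => ?_⟩, ey⟩
        have h4 := hzmin w hw
        have h5 : |r - y| = |r - z| := by
          rw [abs_of_neg (by linarith), abs_of_pos (by linarith)]; linarith
        rw [h5]; exact h4
      · obtain ⟨w, hw, hw1, hw2⟩ := between hp he hx hyF hxy ox ey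
        have := hmin w hw hw1
        linarith
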